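/- Fix k agents and time horizon T. Let A* be a (possibly randomized) allocation rule that is monotone in expectation: for each CTR vector μ ∈ [0,1]^k, each agent i, and each fixed b_{-i}, the expected number of clicks received by agent i under A* (expectation over the independent Bernoulli(μ) clicks and over A*'s internal randomness) is a non-decreasing function of b_i. Then for every γ ∈ (0,1) there exists a mechanism (A,P) such that: (1) A initially makes a random choice, running A* with probability γ and otherwise running the allocation that in each round chooses an agent independently and uniformly at random; (2) for every CTR vector μ ∈ [0,1]^k the mechanism is truthful in expectation, i.e., for every agent i, value v_i > 0 and bid profile b, E[v_i·C_i(v_i,b_{-i};ρ) − P_i(v_i,b_{-i};ρ)] ≥ E[v_i·C_i(b_i,b_{-i};ρ) − P_i(b_i,b_{-i};ρ)]; and (3) for every CTR vector μ it is normalized in expectation, i.e., 0 ≤ E[P_i(b;ρ)] ≤ b_i·E[C_i(b;ρ)] for every agent i and bid profile b (all expectations over the random clicks and the mechanism's internal randomness). -/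

import Mathlib

open Finset

namespace MAB

/-- A realization of clicks: for each agent and each round, whether the agent
would be clicked if shown at that round. -/
abbrev Realization (k T : ℕ) := Fin k → Fin T → Bool

/-- A deterministic allocation rule: maps a bid profile, a realization and a round
to the agent chosen at that round. -/
abbrev Alloc (k T : ℕ) := (Fin k → ℝ) → Realization k T → Fin T → Fin k

/-- A payment rule: maps a bid profile and a realization to the payment
charged to each agent. -/
abbrev Payment (k T : ℕ) := (Fin k → ℝ) → Realization k T → Fin k → ℝ

variable {k T : ℕ}

/-- A bid profile consists of positive reals. -/
def PosBids (b : Fin k → ℝ) : Prop := ∀ i, 0 < b i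

/-- The allocation rule is online: the choice at round `t` is determined by the bids
and the bits observed at rounds `s < t`. -/
def Online (A : Alloc k T) : Prop :=
  ∀ (b : Fin k → ℝ) (ρ ρ' : Realization k T) (t : Fin T),
    (∀ s : Fin T, s < t → ρ (A b ρ s) s = ρ' (A b ρ s) s) → A b ρ t = A b ρ' t

/-- The click-allocation: the number of rounds in which agent `i` is chosen and clicked. -/
def clicks (A : Alloc k T) (b : Fin k → ℝ) (ρ : Realization k T) (i : Fin k) : ℕ :=
  (univ.filter fun t : Fin T => A b ρ t = i ∧ ρ i t = true).card

/-- The payment rule only uses clicks actually observed by the allocation rule. -/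
def PaymentObservable (A : Alloc k T) (P : Payment k T) : Prop :=
  ∀ (b : Fin k → ℝ) (ρ ρ' : Realization k T),
    (∀ t : Fin T, ρ (A b ρ t) t = ρ' (A b ρ t) t) → P b ρ = P b ρ'

/-- The mechanism is normalized: `0 ≤ P_i(b;ρ) ≤ b_i · C_i(b;ρ)`. -/
def Normalized (A : Alloc k T) (P : Payment k T) : Prop :=
  ∀ (b : Fin k → ℝ) (ρ : Realization k T) (i : Fin k), PosBids b →
    0 ≤ P b ρ i ∧ P b ρ i ≤ b i * (clicks A b ρ i : ℝ)

/-- The mechanism is truthful: bidding the true value dominates any other bid. -/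
def Truthful (A : Alloc k T) (P : Payment k T) : Prop :=
  ∀ (b : Fin k → ℝ) (ρ : Realization k T) (i : Fin k) (v : ℝ), PosBids b → 0 < v →
    v * (clicks A (Function.update b i v) ρ i : ℝ) - P (Function.update b i v) ρ i ≥
      v * (clicks A b ρ i : ℝ) - P b ρ i

/-- Pointwise monotonicity: an agent that is played keeps the impression
after increasing her bid. -/
def PointwiseMonotone (A : Alloc k T) : Prop :=
  ∀ (b : Fin k → ℝ) (ρ : Realization k T) (t : Fin T) (i : Fin k) (x : ℝ),
    PosBids b → A b ρ t = i → b i < x → A (Function.update b i x) ρ t = i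

/-- `flip ρ i t` is `ρ ⊕ 1(i,t)`: the realization with the bit of agent `i`
at round `t` flipped. -/
def flip (ρ : Realization k T) (i : Fin k) (t : Fin T) : Realization k T :=
  fun j s => if j = i ∧ s = t then !(ρ j s) else ρ j s

/-- Round `t` is `(b;ρ)`-influential. -/
def InfluentialAt (A : Alloc k T) (b : Fin k → ℝ) (ρ : Realization k T) (t : Fin T) : Prop :=
  ∃ t' : Fin T, t < t' ∧ A b ρ t' ≠ A b (flip ρ (A b ρ t) t) t'

/-- Round `t` is influential for realization `ρ`. -/
def Influential (A : Alloc k T) (ρ : Realization k T) (t : Fin T) : Prop :=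
  ∃ b : Fin k → ℝ, PosBids b ∧ InfluentialAt A b ρ t

/-- The allocation rule is exploration-separated: in any influential round
the allocation does not depend on the bids. -/
def ExplorationSeparated (A : Alloc k T) : Prop :=
  ∀ (ρ : Realization k T) (t : Fin T), Influential A ρ t →
    ∀ b b' : Fin k → ℝ, PosBids b → PosBids b' → A b ρ t = A b' ρ t

/-- Round `t` is `(b;ρ)`-influential with influenced agent `i`. -/
def InfluencedAgent (A : Alloc k T) (b : Fin k → ℝ) (ρ : Realization k T) (t : Fin T)
    (i : Fin k) : Prop :=
  ∃ t' : Fin T, t < t' ∧ A b ρ t' ≠ A b (flip ρ (A b ρ t) t) t' ∧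
    (i = A b ρ t' ∨ i = A b (flip ρ (A b ρ t) t) t')

/-- Round `t` is `(b;ρ)`-secured from agent `i`. -/
def SecuredFrom (A : Alloc k T) (b : Fin k → ℝ) (ρ : Realization k T) (t : Fin T)
    (i : Fin k) : Prop :=
  ∀ x : ℝ, b i < x → A (Function.update b i x) ρ t = A b ρ t

/-- The allocation rule is weakly separated. -/
def WeaklySeparated (A : Alloc k T) : Prop :=
  ∀ (b : Fin k → ℝ) (ρ : Realization k T) (t : Fin T) (i : Fin k),
    PosBids b → InfluencedAgent A b ρ t i → SecuredFrom A b ρ t i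

/-- Non-degeneracy of the allocation rule. -/
def NonDegenerate (A : Alloc k T) : Prop :=
  ∀ (b : Fin k → ℝ) (ρ : Realization k T) (t t' : Fin T), PosBids b → t ≤ t' →
    ∃ l u : ℝ, l < u ∧ l ≤ b (A b ρ t) ∧ b (A b ρ t) ≤ u ∧
      ∀ x ∈ Set.Icc l u, ∀ φ ∈ ({ρ, flip ρ (A b ρ t) t} : Set (Realization k T)),
        ∀ s ∈ ({t, t'} : Set (Fin T)),
          (A (Function.update b (A b ρ t) x) φ s = A b ρ t ↔ A b φ s = A b ρ t)

/-- The allocation rule is scale-free. -/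
def ScaleFree (A : Alloc k T) : Prop :=
  ∀ (c : ℝ) (b : Fin k → ℝ) (ρ : Realization k T) (t : Fin T), 0 < c → PosBids b →
    A (fun j => c * b j) ρ t = A b ρ t

/-- Independence of irrelevant alternatives. -/
def IIA (A : Alloc k T) : Prop :=
  ∀ (b : Fin k → ℝ) (ρ : Realization k T) (t : Fin T) (i : Fin k) (x : ℝ),
    PosBids b → 0 < x → A b ρ t ≠ A (Function.update b i x) ρ t →
    (A b ρ t = i ∨ A (Function.update b i x) ρ t = i)

/-- Round `t` is bid-independent w.r.t. realization `ρ`. -/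
def BidIndependent (A : Alloc k T) (ρ : Realization k T) (t : Fin T) : Prop :=
  ∀ b b' : Fin k → ℝ, PosBids b → PosBids b' → A b ρ t = A b' ρ t

/-- The probability of realization `ρ` when clicks are independent Bernoulli
with CTR vector `μ`. -/
noncomputable def prob (μ : Fin k → ℝ) (ρ : Realization k T) : ℝ :=
  ∏ i : Fin k, ∏ t : Fin T, if ρ i t then μ i else 1 - μ i

/-- A valid CTR vector: all entries in `[0,1]`. -/
def ValidCTR (μ : Fin k → ℝ) : Prop := ∀ i, 0 ≤ μ i ∧ μ i ≤ 1

/-- A valid value profile: all values in `(0, vmax]`. -/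
def ValidValues (vmax : ℝ) (v : Fin k → ℝ) : Prop := ∀ i, 0 < v i ∧ v i ≤ vmax

/-- The regret of allocation rule `A` on the instance with CTRs `μ` and values `v`
(bids equal to the true values). -/
noncomputable def regret (A : Alloc k T) (μ v : Fin k → ℝ) : ℝ :=
  (T : ℝ) * (⨆ i : Fin k, μ i * v i) -
    ∑ ρ : Realization k T, prob μ ρ * ∑ t : Fin T, μ (A v ρ t) * v (A v ρ t)

/-- The worst-case regret `R(T; vmax)`. -/
noncomputable def worstRegret (A : Alloc k T) (vmax : ℝ) : ℝ :=
  sSup {r : ℝ | ∃ μ v : Fin k → ℝ, ValidCTR μ ∧ ValidValues vmax v ∧ r = regret A μ v}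

/-- The instance `(μ, v)` has `δ`-gap: the largest product `μ_i v_i` exceeds
the second largest by `δ · max_i v_i`. -/
def HasGap (μ v : Fin k → ℝ) (δ : ℝ) : Prop :=
  ∃ i : Fin k, (∀ j, μ j * v j ≤ μ i * v i) ∧
    μ i * v i - (⨆ j : {j : Fin k // j ≠ i}, μ j.1 * v j.1) = δ * (⨆ j : Fin k, v j)

/-- The worst-case regret over `δ`-gap instances, `R_δ(T; vmax)`. -/
noncomputable def worstGapRegret (A : Alloc k T) (vmax δ : ℝ) : ℝ :=
  sSup {r : ℝ | ∃ μ v : Fin k → ℝ,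
    ValidCTR μ ∧ ValidValues vmax v ∧ HasGap μ v δ ∧ r = regret A μ v}

/-- The mixed allocation rule: with the first (Boolean) seed component `true` it runs
`A*`, otherwise it plays at each round the agent given by the third seed component
(an independent, uniformly random agent per round). -/
def mixAlloc {k T : ℕ} {Ω₀ : Type} (Astar : Ω₀ → Alloc k T)
    (σ : Bool × Ω₀ × (Fin T → Fin k)) : Alloc k T :=
  if σ.1 then Astar σ.2.1 else fun _ _ t => σ.2.2 t

/-- The seed distribution of the mixed mechanism: `A*` is run with probability `γ`
(seed `true`), otherwise the uniformly random allocation is run; the random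
round-by-round choices are uniform over the `k^T` functions `Fin T → Fin k`. -/
noncomputable def mixWeight (k T : ℕ) {Ω₀ : Type} (γ : ℝ) (w₀ : Ω₀ → ℝ)
    (σ : Bool × Ω₀ × (Fin T → Fin k)) : ℝ :=
  (if σ.1 then γ * w₀ σ.2.1 else (1 - γ) * w₀ σ.2.1) * (1 / (k : ℝ) ^ T)

/-- Integration over `[0, B]` extends to a linear functional on all functions `ℝ → ℝ`,
measurable or not. -/
theorem exists_linearMap_eq_integral (B : ℝ) :
    ∃ L : (ℝ → ℝ) →ₗ[ℝ] ℝ, ∀ f : ℝ → ℝ,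
      IntervalIntegrable f MeasureTheory.volume 0 B → L f = ∫ x in (0 : ℝ)..B, f x := by
  let p : Submodule ℝ (ℝ → ℝ) :=
    { carrier := {f | IntervalIntegrable f MeasureTheory.volume 0 B}
      add_mem' := fun hf hg => IntervalIntegrable.add hf hg
      zero_mem' := intervalIntegrable_const (c := (0 : ℝ))
      smul_mem' := fun c _ hf => IntervalIntegrable.smul hf c }
  let I : p →ₗ[ℝ] ℝ :=
    { toFun := fun f => ∫ x in (0 : ℝ)..B, f.1 x
      map_add' := fun f g => intervalIntegral.integral_add f.2 g.2
      map_smul' := fun c f => intervalIntegral.integral_smul c f.1 }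
  obtain ⟨L, hL⟩ := LinearMap.exists_extend I
  exact ⟨L, fun f hf => LinearMap.congr_fun hL ⟨f, hf⟩⟩

/-- A linear functional on all functions `ℝ → ℝ` that agrees with the integral over `[0, B]`
on the functions integrable there. -/
noncomputable def extIntegral (B : ℝ) : (ℝ → ℝ) →ₗ[ℝ] ℝ :=
  (exists_linearMap_eq_integral B).choose

theorem extIntegral_eq_integral {B : ℝ} {f : ℝ → ℝ}
    (hf : IntervalIntegrable f MeasureTheory.volume 0 B) :
    extIntegral B f = ∫ x in (0 : ℝ)..B, f x :=
  (exists_linearMap_eq_integral B).choose_spec f hf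

/-- For monotone `G`, the increment of the integral dominates the increment of its tangent. -/
theorem sub_mul_le_integral_of_monotone {G : ℝ → ℝ} (hG : Monotone G) (a c : ℝ) :
    (c - a) * G a ≤ ∫ x in a..c, G x := by
  rcases le_total a c with h | h
  · have := intervalIntegral.integral_mono_on h (intervalIntegrable_const (c := G a))
      (hG.intervalIntegrable (μ := MeasureTheory.volume)) fun x hx => hG hx.1
    simpa using this
  · have := intervalIntegral.integral_mono_on h (hG.intervalIntegrable (μ := MeasureTheory.volume))
      (intervalIntegrable_const (c := G a)) fun x hx => hG hx.2
    rw [intervalIntegral.integral_symm]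
    simp only [intervalIntegral.integral_const, smul_eq_mul] at this
    linarith

/-- The utility inequality for the Myerson payment of a monotone allocation curve. -/
theorem myerson_utility_le {G : ℝ → ℝ} (hG : Monotone G) (a v : ℝ) :
    v * G a - (a * G a - ∫ x in (0 : ℝ)..a, G x) ≤ ∫ x in (0 : ℝ)..v, G x := by
  have h := sub_mul_le_integral_of_monotone hG a v
  have h' := intervalIntegral.integral_add_adjacent_intervals
    (hG.intervalIntegrable (μ := MeasureTheory.volume) (a := 0) (b := a))
    (hG.intervalIntegrable (μ := MeasureTheory.volume) (b := v))
  linarith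

theorem prob_nonneg {μ : Fin k → ℝ} (hμ : ValidCTR μ) (ρ : Realization k T) :
    0 ≤ prob μ ρ := by
  refine prod_nonneg fun i _ => prod_nonneg fun t _ => ?_
  have := hμ i
  split_ifs <;> linarith

/-- An online rule run on two realizations that agree along a prescribed sequence of agents
either plays that sequence on both or on neither. -/
theorem Online.eq_of_agree {A : Alloc k T} (hA : Online A) {b : Fin k → ℝ}
    {ρ ρ' : Realization k T} {f : Fin T → Fin k} (h : ∀ t, ρ (f t) t = ρ' (f t) t)
    (hf : A b ρ = f) : A b ρ' = f := by
  subst hf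
  funext t
  exact (hA b ρ ρ' t fun s _ => h s).symm

theorem clicks_congr {A : Alloc k T} {b : Fin k → ℝ} {ρ ρ' : Realization k T}
    (hA : A b ρ = A b ρ') (h : ∀ t, ρ (A b ρ t) t = ρ' (A b ρ t) t) (i : Fin k) :
    clicks A b ρ i = clicks A b ρ' i := by
  unfold clicks
  congr 1
  refine filter_congr fun t _ => ?_
  rw [← hA]
  constructor
  · rintro ⟨rfl, hc⟩
    exact ⟨rfl, (h t).symm.trans hc⟩
  · rintro ⟨rfl, hc⟩
    exact ⟨rfl, (h t).trans hc⟩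

/-- The clicks of agent `i` as a function of her own (positive) bid `x`, counted only
if the rule plays exactly the sequence of agents `f`. -/
noncomputable def clicksAlong (A : Alloc k T) (b : Fin k → ℝ) (i : Fin k)
    (f : Fin T → Fin k) (ρ : Realization k T) (x : ℝ) : ℝ :=
  if 0 < x ∧ A (Function.update b i x) ρ = f then
    (clicks A (Function.update b i x) ρ i : ℝ) else 0

theorem clicksAlong_congr {A : Alloc k T} (hA : Online A) (b : Fin k → ℝ) (i : Fin k)
    {f : Fin T → Fin k} {ρ ρ' : Realization k T} (h : ∀ t, ρ (f t) t = ρ' (f t) t) :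
    clicksAlong A b i f ρ = clicksAlong A b i f ρ' := by
  funext x
  unfold clicksAlong
  by_cases hf : A (Function.update b i x) ρ = f
  · have hf' := hA.eq_of_agree h hf
    rw [clicks_congr (hf.trans hf'.symm) (by rw [hf]; exact h)]
    simp [hf, hf']
  · have hf' : A (Function.update b i x) ρ' ≠ f :=
      fun h' => hf (hA.eq_of_agree (fun t => (h t).symm) h')
    simp [hf, hf']

theorem sum_clicksAlong (A : Alloc k T) (b : Fin k → ℝ) (i : Fin k) (ρ : Realization k T)
    (x : ℝ) :
    ∑ f, clicksAlong A b i f ρ x =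
      if 0 < x then (clicks A (Function.update b i x) ρ i : ℝ) else 0 := by
  by_cases hx : 0 < x <;> simp [clicksAlong, hx]

section Mixing

variable {Ω₀ : Type}

/-- The payment rule: charge the bid per click when `A*` is run, and on a uniformly random
run give back an importance-weighted estimate of the information rent. -/
noncomputable def mixPayment (Astar : Ω₀ → Alloc k T) (γ : ℝ)
    (σ : Bool × Ω₀ × (Fin T → Fin k)) : Payment k T := fun b ρ i =>
  if σ.1 then b i * (clicks (Astar σ.2.1) b ρ i : ℝ)
  else -(γ / (1 - γ) * (k : ℝ) ^ T *
    extIntegral (b i) (clicksAlong (Astar σ.2.1) b i σ.2.2 ρ))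

theorem mixPayment_congr {Astar : Ω₀ → Alloc k T} (hOn : ∀ ω, Online (Astar ω)) (γ : ℝ)
    (σ : Bool × Ω₀ × (Fin T → Fin k)) (b : Fin k → ℝ) (ρ ρ' : Realization k T)
    (h : ∀ t, ρ (mixAlloc Astar σ b ρ t) t = ρ' (mixAlloc Astar σ b ρ t) t) :
    mixPayment Astar γ σ b ρ = mixPayment Astar γ σ b ρ' := by
  obtain ⟨c, ω, f⟩ := σ
  funext i
  cases c
  · have h' : ∀ t, ρ (f t) t = ρ' (f t) t := h
    simp [mixPayment, clicksAlong_congr (hOn ω) b i h']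
  · have h' : ∀ t, ρ (Astar ω b ρ t) t = ρ' (Astar ω b ρ t) t := h
    simp [mixPayment, clicks_congr ((hOn ω).eq_of_agree h' rfl).symm h' i]

variable [Fintype Ω₀]

theorem sum_mixWeight_mul (hk : 0 < k) (γ : ℝ) (w₀ : Ω₀ → ℝ)
    (F : Bool × Ω₀ × (Fin T → Fin k) → ℝ) (X : Ω₀ → ℝ) (hX : ∀ ω f, F (true, ω, f) = X ω) :
    ∑ σ, mixWeight k T γ w₀ σ * F σ =
      γ * ∑ ω, w₀ ω * X ω +
        (1 - γ) * ∑ ω, w₀ ω * (1 / (k : ℝ) ^ T * ∑ f, F (false, ω, f)) := by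
  have hkT : (k : ℝ) ^ T ≠ 0 := pow_ne_zero _ (by exact_mod_cast hk.ne')
  simp only [Fintype.sum_prod_type, Fintype.sum_bool, mixWeight, if_true, Bool.false_eq_true,
    if_false, hX, mul_sum]
  congr 1
  · refine sum_congr rfl fun ω _ => ?_
    simp only [sum_const, card_univ, Fintype.card_pi, Fintype.card_fin, prod_const, nsmul_eq_mul]
    push_cast
    field_simp
  · exact sum_congr rfl fun ω _ => sum_congr rfl fun f _ => by ring

/-- The expected number of clicks of agent `i` under the randomized rule `A*`. -/
noncomputable def expClicks (w₀ : Ω₀ → ℝ) (Astar : Ω₀ → Alloc k T) (μ : Fin k → ℝ)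
    (i : Fin k) (b : Fin k → ℝ) : ℝ :=
  ∑ ω, w₀ ω * ∑ ρ : Realization k T, prob μ ρ * (clicks (Astar ω) b ρ i : ℝ)

theorem expClicks_nonneg {w₀ : Ω₀ → ℝ} (hw₀ : ∀ ω, 0 ≤ w₀ ω) (Astar : Ω₀ → Alloc k T)
    {μ : Fin k → ℝ} (hμ : ValidCTR μ) (i : Fin k) (b : Fin k → ℝ) :
    0 ≤ expClicks w₀ Astar μ i b :=
  sum_nonneg fun ω _ => mul_nonneg (hw₀ ω) <| sum_nonneg fun ρ _ =>
    mul_nonneg (prob_nonneg hμ ρ) (Nat.cast_nonneg _)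

/-- The expected clicks of agent `i` as a function of her own bid, extended by zero to
non-positive bids. -/
noncomputable def clickCurve (w₀ : Ω₀ → ℝ) (Astar : Ω₀ → Alloc k T) (μ : Fin k → ℝ)
    (i : Fin k) (b : Fin k → ℝ) (x : ℝ) : ℝ :=
  if 0 < x then expClicks w₀ Astar μ i (Function.update b i x) else 0

theorem clickCurve_self (w₀ : Ω₀ → ℝ) (Astar : Ω₀ → Alloc k T) (μ : Fin k → ℝ)
    {i : Fin k} {b : Fin k → ℝ} (hb : 0 < b i) :
    clickCurve w₀ Astar μ i b (b i) = expClicks w₀ Astar μ i b := by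
  simp [clickCurve, hb]

theorem clickCurve_update (w₀ : Ω₀ → ℝ) (Astar : Ω₀ → Alloc k T) (μ : Fin k → ℝ)
    (i : Fin k) (b : Fin k → ℝ) (v : ℝ) :
    clickCurve w₀ Astar μ i (Function.update b i v) = clickCurve w₀ Astar μ i b := by
  funext x
  simp [clickCurve]

theorem clickCurve_monotone {w₀ : Ω₀ → ℝ} (hw₀ : ∀ ω, 0 ≤ w₀ ω) {Astar : Ω₀ → Alloc k T}
    {μ : Fin k → ℝ} (hμ : ValidCTR μ) {i : Fin k} {b : Fin k → ℝ}
    (hmono : ∀ x y : ℝ, 0 < x → x ≤ y → expClicks w₀ Astar μ i (Function.update b i x) ≤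
      expClicks w₀ Astar μ i (Function.update b i y)) :
    Monotone (clickCurve w₀ Astar μ i b) := by
  intro x y hxy
  unfold clickCurve
  by_cases hx : 0 < x
  · simpa [hx, hx.trans_le hxy] using hmono x y hx hxy
  · rw [if_neg hx]
    split_ifs
    exacts [expClicks_nonneg hw₀ Astar hμ i _, le_rfl]

theorem clickCurve_eq_sum (w₀ : Ω₀ → ℝ) (Astar : Ω₀ → Alloc k T) (μ : Fin k → ℝ)
    (i : Fin k) (b : Fin k → ℝ) :
    clickCurve w₀ Astar μ i b =
      ∑ ω, w₀ ω • ∑ f, ∑ ρ : Realization k T, prob μ ρ • clicksAlong (Astar ω) b i f ρ := by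
  funext x
  simp only [Finset.sum_apply, Pi.smul_apply, smul_eq_mul]
  have h : ∀ ω, ∑ f, ∑ ρ : Realization k T, prob μ ρ * clicksAlong (Astar ω) b i f ρ x =
      ∑ ρ : Realization k T, prob μ ρ *
        if 0 < x then (clicks (Astar ω) (Function.update b i x) ρ i : ℝ) else 0 := fun ω => by
    rw [sum_comm]
    simp only [← mul_sum, sum_clicksAlong]
  simp only [h, clickCurve, expClicks]
  split_ifs <;> simp

theorem sum_mixPayment (hk : 0 < k) {γ : ℝ} (hγ1 : γ < 1) (w₀ : Ω₀ → ℝ)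
    (Astar : Ω₀ → Alloc k T) (μ : Fin k → ℝ) (i : Fin k) (b : Fin k → ℝ) :
    (∑ σ, mixWeight k T γ w₀ σ *
        ∑ ρ : Realization k T, prob μ ρ * mixPayment Astar γ σ b ρ i) =
      γ * (b i * expClicks w₀ Astar μ i b -
        extIntegral (b i) (clickCurve w₀ Astar μ i b)) := by
  have hkT : (k : ℝ) ^ T ≠ 0 := pow_ne_zero _ (by exact_mod_cast hk.ne')
  have hγ : 1 - γ ≠ 0 := by linarith
  rw [sum_mixWeight_mul hk γ w₀ _
    (fun ω => ∑ ρ : Realization k T, prob μ ρ * (b i * (clicks (Astar ω) b ρ i : ℝ)))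
    (fun ω f => by simp [mixPayment]), clickCurve_eq_sum, expClicks]
  simp only [map_sum, map_smul, smul_eq_mul, mixPayment, Bool.false_eq_true, if_false,
    mul_sub γ, mul_sum, mul_neg, sum_neg_distrib]
  conv_rhs => rw [sub_eq_add_neg]
  congr 1
  · exact sum_congr rfl fun ω _ => sum_congr rfl fun ρ _ => by ring
  · rw [neg_inj]
    refine sum_congr rfl fun ω _ => sum_congr rfl fun f _ => sum_congr rfl fun ρ _ => ?_
    field_simp

theorem exists_sum_clicks_mixAlloc (hk : 0 < k) {γ : ℝ} (hγ1 : γ < 1) {w₀ : Ω₀ → ℝ}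
    (hw₀ : ∀ ω, 0 ≤ w₀ ω) (Astar : Ω₀ → Alloc k T) {μ : Fin k → ℝ} (hμ : ValidCTR μ)
    (i : Fin k) :
    ∃ E : ℝ, 0 ≤ E ∧ ∀ b : Fin k → ℝ,
      (∑ σ, mixWeight k T γ w₀ σ *
        ∑ ρ : Realization k T, prob μ ρ * (clicks (mixAlloc Astar σ) b ρ i : ℝ)) =
      γ * expClicks w₀ Astar μ i b + E := by
  refine ⟨(1 - γ) * ∑ ω, w₀ ω * (1 / (k : ℝ) ^ T * ∑ f : Fin T → Fin k,
    ∑ ρ : Realization k T, prob μ ρ * (clicks (fun _ _ t => f t) 0 ρ i : ℝ)), ?_, fun b => ?_⟩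
  · refine mul_nonneg (by linarith) <| sum_nonneg fun ω _ => mul_nonneg (hw₀ ω) <|
      mul_nonneg (by positivity) <| sum_nonneg fun f _ => sum_nonneg fun ρ _ =>
        mul_nonneg (prob_nonneg hμ ρ) (Nat.cast_nonneg _)
  · exact sum_mixWeight_mul hk γ w₀ _
      (fun ω => ∑ ρ : Realization k T, prob μ ρ * (clicks (Astar ω) b ρ i : ℝ))
      (fun _ _ => rfl)

end Mixing

/-- Any (randomized) allocation rule `A*` that is monotone in
expectation can be turned, for any `γ ∈ (0,1)`, into a mechanism `(A,P)` where `A`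
runs `A*` with probability `γ` and otherwise plays a uniformly random agent in each
round, and which is truthful in expectation and normalized in expectation for every
CTR vector. -/
theorem monotone_in_expectation_truthful_in_expectation (k T : ℕ) (hk : 0 < k)
    (Ω₀ : Type) [Fintype Ω₀] (w₀ : Ω₀ → ℝ)
    (hw₀ : ∀ ω, 0 ≤ w₀ ω) (hw₀sum : (∑ ω, w₀ ω) = 1)
    (Astar : Ω₀ → Alloc k T) (hOn : ∀ ω, Online (Astar ω))
    (hmono : ∀ μ : Fin k → ℝ, ValidCTR μ → ∀ (i : Fin k) (b : Fin k → ℝ), PosBids b →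
      ∀ x y : ℝ, 0 < x → x ≤ y →
        (∑ ω, w₀ ω * ∑ ρ : Realization k T,
            prob μ ρ * (clicks (Astar ω) (Function.update b i x) ρ i : ℝ)) ≤
        (∑ ω, w₀ ω * ∑ ρ : Realization k T,
            prob μ ρ * (clicks (Astar ω) (Function.update b i y) ρ i : ℝ)))
    (γ : ℝ) (hγ0 : 0 < γ) (hγ1 : γ < 1) :
    ∃ P : (Bool × Ω₀ × (Fin T → Fin k)) → Payment k T,
      -- the payment uses only observed clicks
      (∀ (σ : Bool × Ω₀ × (Fin T → Fin k)) (b : Fin k → ℝ) (ρ ρ' : Realization k T),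
        (∀ t : Fin T, ρ (mixAlloc Astar σ b ρ t) t = ρ' (mixAlloc Astar σ b ρ t) t) →
          P σ b ρ = P σ b ρ') ∧
      -- truthful in expectation
      (∀ μ : Fin k → ℝ, ValidCTR μ → ∀ (i : Fin k) (b : Fin k → ℝ) (v : ℝ),
        PosBids b → 0 < v →
        (∑ σ : Bool × Ω₀ × (Fin T → Fin k), mixWeight k T γ w₀ σ *
            ∑ ρ : Realization k T, prob μ ρ *
              (v * (clicks (mixAlloc Astar σ) (Function.update b i v) ρ i : ℝ) -
                P σ (Function.update b i v) ρ i)) ≥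
        (∑ σ : Bool × Ω₀ × (Fin T → Fin k), mixWeight k T γ w₀ σ *
            ∑ ρ : Realization k T, prob μ ρ *
              (v * (clicks (mixAlloc Astar σ) b ρ i : ℝ) - P σ b ρ i))) ∧
      -- normalized in expectation
      (∀ μ : Fin k → ℝ, ValidCTR μ → ∀ (i : Fin k) (b : Fin k → ℝ), PosBids b →
        0 ≤ (∑ σ : Bool × Ω₀ × (Fin T → Fin k), mixWeight k T γ w₀ σ *
              ∑ ρ : Realization k T, prob μ ρ * P σ b ρ i) ∧
        (∑ σ : Bool × Ω₀ × (Fin T → Fin k), mixWeight k T γ w₀ σ *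
              ∑ ρ : Realization k T, prob μ ρ * P σ b ρ i) ≤
          b i * ∑ σ : Bool × Ω₀ × (Fin T → Fin k), mixWeight k T γ w₀ σ *
              ∑ ρ : Realization k T, prob μ ρ * (clicks (mixAlloc Astar σ) b ρ i : ℝ)) := by
  have curve_mono : ∀ μ, ValidCTR μ → ∀ (i : Fin k) (b : Fin k → ℝ), PosBids b →
      Monotone (clickCurve w₀ Astar μ i b) := fun μ hμ i b hb =>
    clickCurve_monotone hw₀ hμ (hmono μ hμ i b hb)
  have pay : ∀ μ, ValidCTR μ → ∀ (i : Fin k) (b : Fin k → ℝ), PosBids b →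
      (∑ σ, mixWeight k T γ w₀ σ *
        ∑ ρ : Realization k T, prob μ ρ * mixPayment Astar γ σ b ρ i) =
      γ * (b i * clickCurve w₀ Astar μ i b (b i) -
        ∫ x in (0 : ℝ)..b i, clickCurve w₀ Astar μ i b x) := fun μ hμ i b hb => by
    rw [sum_mixPayment hk hγ1,
      extIntegral_eq_integral (curve_mono μ hμ i b hb).intervalIntegrable,
      clickCurve_self _ _ _ (hb i)]
  refine ⟨mixPayment Astar γ, mixPayment_congr hOn γ, ?_, ?_⟩
  · intro μ hμ i b v hb hv
    obtain ⟨E, -, hE⟩ := exists_sum_clicks_mixAlloc hk hγ1 hw₀ Astar hμ i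
    have utility : ∀ b' : Fin k → ℝ, PosBids b' →
        (∑ σ : Bool × Ω₀ × (Fin T → Fin k), mixWeight k T γ w₀ σ *
          ∑ ρ : Realization k T, prob μ ρ *
            (v * (clicks (mixAlloc Astar σ) b' ρ i : ℝ) - mixPayment Astar γ σ b' ρ i)) =
        v * E + γ * (v * clickCurve w₀ Astar μ i b' (b' i) -
          (b' i * clickCurve w₀ Astar μ i b' (b' i) -
            ∫ x in (0 : ℝ)..b' i, clickCurve w₀ Astar μ i b' x)) := fun b' hb' => by
      have h₁ := pay μ hμ i b' hb'
      have h₂ := hE b'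
      rw [← clickCurve_self _ _ _ (hb' i)] at h₂
      have h₃ : (∑ σ : Bool × Ω₀ × (Fin T → Fin k), mixWeight k T γ w₀ σ *
          ∑ ρ : Realization k T, prob μ ρ *
            (v * (clicks (mixAlloc Astar σ) b' ρ i : ℝ) - mixPayment Astar γ σ b' ρ i)) =
          v * (∑ σ, mixWeight k T γ w₀ σ *
            ∑ ρ : Realization k T, prob μ ρ * (clicks (mixAlloc Astar σ) b' ρ i : ℝ)) -
          ∑ σ, mixWeight k T γ w₀ σ *
            ∑ ρ : Realization k T, prob μ ρ * mixPayment Astar γ σ b' ρ i := by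
        simp only [mul_sub, sum_sub_distrib, mul_sum]
        congr 1
        exact sum_congr rfl fun σ _ => sum_congr rfl fun ρ _ => by ring
      rw [h₃, h₁, h₂]
      ring
    have hbv : PosBids (Function.update b i v) := fun j => by
      by_cases hj : j = i
      · subst hj
        simpa using hv
      · simpa [hj] using hb j
    rw [ge_iff_le, utility b hb, utility _ hbv, clickCurve_update, Function.update_self,
      sub_sub_cancel]
    gcongr
    exact myerson_utility_le (curve_mono μ hμ i b hb) (b i) v
  · intro μ hμ i b hb
    obtain ⟨E, hE0, hE⟩ := exists_sum_clicks_mixAlloc hk hγ1 hw₀ Astar hμ i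
    have hG := curve_mono μ hμ i b hb
    rw [pay μ hμ i b hb, hE b, ← clickCurve_self _ _ _ (hb i)]
    have h_lower := sub_mul_le_integral_of_monotone hG (b i) 0
    have h_zero := sub_mul_le_integral_of_monotone hG 0 (b i)
    have hG0 : clickCurve w₀ Astar μ i b 0 = 0 := by simp [clickCurve]
    rw [intervalIntegral.integral_symm] at h_lower
    rw [hG0, mul_zero] at h_zero
    refine ⟨mul_nonneg hγ0.le (by linarith), ?_⟩
    nlinarith [mul_nonneg hγ0.le h_zero, mul_nonneg (hb i).le hE0]

end MAB
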